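/- For n = 2, there exists a valid configuration x of the tileset τ_σ on BS(1,2) such that x_{b² g} = x_g for all g ∈ BS(1,2). In particular, the set of valid configurations of τ_σ on BS(1,2) is nonempty and contains a weakly periodic configuration (one fixed by the translation by b²). -/

import Mathlib

/-- The Baumslag–Solitar relation `b a^m b⁻¹ (a^n)⁻¹` in the free group on two generators. -/
def BSrel (m n : ℤ) : Set (FreeGroup (Fin 2)) :=
  {FreeGroup.of 1 * FreeGroup.of 0 ^ m * (FreeGroup.of 1)⁻¹ * (FreeGroup.of 0 ^ n)⁻¹}

/-- The Baumslag–Solitar group `BS(m,n) = ⟨a, b ∣ b a^m b⁻¹ = a^n⟩`. -/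
abbrev BS (m n : ℤ) : Type := PresentedGroup (BSrel m n)

/-- The generator `a` of `BS(m,n)`. -/
def BSa (m n : ℤ) : BS m n := PresentedGroup.of 0

/-- The generator `b` of `BS(m,n)`. -/
def BSb (m n : ℤ) : BS m n := PresentedGroup.of 1

/-- The letter at position `i` (indexed from `0`) of the length-`n` word `σ_r(c)`,
where `σ_r(0) = 0^{n-r-1} 1 0^r` and `σ_r(1) = 0^n`: it is `1` iff `c = 0` and
`i = n - 1 - r`. -/
def sigmaLetter (n r : ℕ) (c : Fin 2) (i : ℕ) : Fin 2 :=
  if c = 0 ∧ i = n - 1 - r then 1 else 0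

/-- A valid configuration of the tileset `τ_σ` on `BS(1,n)`: a map
`x : BS(1,n) → {0,1} × {0,…,n−1}`, `x g = (c_g, i_g)`, such that for every `g`:
(i) `i_{ga} = i_g`, and (ii) for every `l ∈ {1,…,n}`, `c_g = σ_{i_h}(c_h)_{l−1}` where
`h = g a^{1−l} b`. -/
def ValidConfig (n : ℕ) (x : BS 1 (n : ℤ) → Fin 2 × Fin n) : Prop :=
  ∀ g : BS 1 (n : ℤ),
    (x (g * BSa 1 (n : ℤ))).2 = (x g).2 ∧
    ∀ l : ℕ, 1 ≤ l → l ≤ n →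
      (x g).1 =
        sigmaLetter n ((x (g * BSa 1 (n : ℤ) ^ (1 - (l : ℤ)) * BSb 1 (n : ℤ))).2 : ℕ)
          ((x (g * BSa 1 (n : ℤ) ^ (1 - (l : ℤ)) * BSb 1 (n : ℤ))).1) (l - 1)

/-- The two-sided period doubling sequence `n ↦ v₂(n) mod 2`, with the prescribed value `e` at the
undetermined position `0`. -/
def periodDoubling (n : ℤ) (e : Fin 2) : Fin 2 :=
  if n = 0 then e else Fin.ofNat 2 (padicValInt 2 n)

theorem periodDoubling_of_odd {n : ℤ} (hn : Odd n) (e : Fin 2) : periodDoubling n e = 0 := by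
  have h0 : n ≠ 0 := by rintro rfl; simp at hn
  have h2 : ¬ ((2 : ℕ) : ℤ) ∣ n := by
    obtain ⟨k, rfl⟩ := hn
    push_cast
    omega
  simp [periodDoubling, h0, padicValInt.eq_zero_of_not_dvd h2]

theorem periodDoubling_two_mul (n : ℤ) (e : Fin 2) :
    periodDoubling (2 * n) e = periodDoubling n (e + 1) + 1 := by
  rcases eq_or_ne n 0 with rfl | h0
  · revert e
    decide
  · have h : padicValInt 2 (2 * n) = padicValInt 2 n + 1 := by
      rw [padicValInt.mul two_ne_zero h0, add_comm]
      simp [padicValInt]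
    simp only [periodDoubling, mul_eq_zero, OfNat.ofNat_ne_zero, h0, or_self, if_false, h]
    ext
    simp [Fin.val_add]

/-- The translation by which the generator `a` acts on `ℚ × Fin 2`. -/
def translationPerm : Equiv.Perm (ℚ × Fin 2) where
  toFun s := (s.1 - 1, s.2)
  invFun s := (s.1 + 1, s.2)
  left_inv s := by simp
  right_inv s := by simp

/-- The dilation, combined with a flip, by which the generator `b` acts on `ℚ × Fin 2`. -/
def dilationPerm : Equiv.Perm (ℚ × Fin 2) where
  toFun s := (2 * s.1, s.2 + 1)
  invFun s := (s.1 / 2, s.2 + 1)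
  left_inv s := by
    obtain ⟨t, e⟩ := s
    have he : e + 1 + 1 = e := by revert e; decide
    simp [he]
  right_inv s := by
    obtain ⟨t, e⟩ := s
    have he : e + 1 + 1 = e := by revert e; decide
    simp [he, mul_div_cancel₀]

/-- The affine action of `BS(1,2)` on `ℚ × Fin 2`. -/
def affineAction : BS 1 2 →* Equiv.Perm (ℚ × Fin 2) :=
  PresentedGroup.toGroup (f := ![translationPerm, dilationPerm]) (by
    intro r hr
    rw [BSrel, Set.mem_singleton_iff] at hr
    subst hr
    simp only [map_mul, map_inv, map_zpow, FreeGroup.lift_apply_of, Matrix.cons_val_zero,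
      Matrix.cons_val_one, zpow_one]
    rw [mul_inv_eq_one, mul_inv_eq_iff_eq_mul]
    ext s
    · simp [translationPerm, dilationPerm, zpow_ofNat, pow_two]
      ring
    · simp [translationPerm, dilationPerm, zpow_ofNat, pow_two])

theorem affineAction_a : affineAction (BSa 1 2) = translationPerm :=
  PresentedGroup.toGroup.of _

theorem affineAction_b : affineAction (BSb 1 2) = dilationPerm :=
  PresentedGroup.toGroup.of _

/-- The position of `g : BS(1,2)`: the orbit map of the right action by inverses. -/
def position (g : BS 1 2) : ℚ × Fin 2 := (affineAction g)⁻¹ (0, 0)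

theorem position_mul_a (g : BS 1 2) :
    position (g * BSa 1 2) = ((position g).1 + 1, (position g).2) := by
  simp only [position, map_mul, affineAction_a, mul_inv_rev, Equiv.Perm.mul_apply]
  rfl

theorem position_mul_a_inv (g : BS 1 2) :
    position (g * (BSa 1 2)⁻¹) = ((position g).1 - 1, (position g).2) := by
  simp only [position, map_mul, map_inv, affineAction_a, mul_inv_rev, inv_inv,
    Equiv.Perm.mul_apply]
  rfl

theorem position_mul_b (g : BS 1 2) :
    position (g * BSb 1 2) = ((position g).1 / 2, (position g).2 + 1) := by
  simp only [position, map_mul, affineAction_b, mul_inv_rev, Equiv.Perm.mul_apply]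
  rfl

theorem position_b_sq_mul (g : BS 1 2) : position (BSb 1 2 ^ 2 * g) = position g := by
  have h : (dilationPerm ^ 2)⁻¹ (0, 0) = (0, 0) := by
    rw [Equiv.Perm.inv_eq_iff_eq]
    simp [dilationPerm, pow_two]
  simp only [position, map_mul, map_pow, affineAction_b, mul_inv_rev, Equiv.Perm.mul_apply, h]

/-- The tile placed at a given position. -/
def positionTile (s : ℚ × Fin 2) : Fin 2 × Fin 2 :=
  (periodDoubling ⌈s.1⌉ s.2, if Even ⌈2 * s.1⌉ then 1 else 0)

theorem positionTile_add_one_snd (t : ℚ) (e : Fin 2) :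
    (positionTile (t + 1, e)).2 = (positionTile (t, e)).2 := by
  have h : ⌈2 * (t + 1)⌉ = ⌈2 * t⌉ + 2 := by
    rw [← Int.ceil_add_ofNat]
    congr 1
    ring
  simp [positionTile, h]

theorem sigmaLetter_two_of_eq (r c : Fin 2) (i : ℕ) (h : i + r = 1) :
    sigmaLetter 2 r c i = c + 1 := by
  have hi : i = 2 - 1 - (r : ℕ) := by omega
  simp only [sigmaLetter, hi, and_true]
  revert c
  decide

theorem sigmaLetter_two_of_ne (r c : Fin 2) (i : ℕ) (h : i + r ≠ 1) :
    sigmaLetter 2 r c i = 0 := by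
  have hi : i ≠ 2 - 1 - (r : ℕ) := by omega
  simp [sigmaLetter, hi]

theorem positionTile_fst_eq_left (t : ℚ) (e : Fin 2) :
    (positionTile (t, e)).1 =
      sigmaLetter 2 (positionTile (t / 2, e + 1)).2 (positionTile (t / 2, e + 1)).1 0 := by
  have h2 : 2 * (t / 2) = t := by ring
  rcases Int.even_or_odd' ⌈t⌉ with ⟨m, h | h⟩
  · have hm : ⌈t / 2⌉ = m := by
      rw [Int.ceil_eq_iff] at h ⊢
      push_cast at h
      constructor <;> linarith
    rw [sigmaLetter_two_of_eq _ _ _ (by simp [positionTile, h2, h])]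
    simp [positionTile, h, hm, periodDoubling_two_mul]
  · rw [sigmaLetter_two_of_ne _ _ _ (by simp [positionTile, h2, h, Int.not_odd_iff_even.2])]
    exact periodDoubling_of_odd ⟨m, h⟩ e

theorem positionTile_fst_eq_right (t : ℚ) (e : Fin 2) :
    (positionTile (t, e)).1 =
      sigmaLetter 2 (positionTile ((t - 1) / 2, e + 1)).2
        (positionTile ((t - 1) / 2, e + 1)).1 1 := by
  have h2 : ⌈2 * ((t - 1) / 2)⌉ = ⌈t⌉ - 1 := by
    rw [← Int.ceil_sub_one]
    congr 1
    ring
  rcases Int.even_or_odd' ⌈t⌉ with ⟨m, h | h⟩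
  · have hm : ⌈(t - 1) / 2⌉ = m := by
      rw [Int.ceil_eq_iff] at h ⊢
      push_cast at h
      constructor <;> linarith
    rw [sigmaLetter_two_of_eq _ _ _ (by simp [positionTile, h2, h])]
    simp [positionTile, h, hm, periodDoubling_two_mul]
  · rw [sigmaLetter_two_of_ne _ _ _ (by simp [positionTile, h2, h])]
    exact periodDoubling_of_odd ⟨m, h⟩ e

/-- For `n = 2`, there is a valid configuration of `τ_σ` on `BS(1,2)` that is fixed by
translation by `b²`; in particular the set of valid configurations is nonempty and
contains a weakly periodic configuration. -/
theorem exists_b2_periodic_valid_config :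
    ∃ x : BS 1 (2 : ℤ) → Fin 2 × Fin 2, ValidConfig 2 x ∧
      ∀ g : BS 1 (2 : ℤ), x (BSb 1 (2 : ℤ) ^ 2 * g) = x g := by
  refine ⟨fun g => positionTile (position g), fun g => ⟨?_, fun l h1 h2 => ?_⟩, fun g => ?_⟩
  · change (positionTile (position (g * BSa 1 2))).2 = _
    rw [position_mul_a, positionTile_add_one_snd]
  · obtain rfl | rfl : l = 1 ∨ l = 2 := by omega
    · have hg : position (g * BSa 1 2 ^ (1 - ((1 : ℕ) : ℤ)) * BSb 1 2) =
          ((position g).1 / 2, (position g).2 + 1) := by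
        simp [position_mul_b]
      have h := positionTile_fst_eq_left (position g).1 (position g).2
      rw [← hg] at h
      exact h
    · have hg : position (g * BSa 1 2 ^ (1 - ((2 : ℕ) : ℤ)) * BSb 1 2) =
          (((position g).1 - 1) / 2, (position g).2 + 1) := by
        simp [position_mul_b, position_mul_a_inv]
      have h := positionTile_fst_eq_right (position g).1 (position g).2
      rw [← hg] at h
      exact h
  · simp only [position_b_sq_mul]
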